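/- Let q be a complex number with |q| < 1 and let a, b be complex numbers with 1 + a q^N ≠ 0 and 1 + b q^N ≠ 0 for every positive integer N. Then (−bq; q)_∞ · ∑_{n=0}^{∞} a^n q^{n(n+1)/2} / ((q; q)_n · (−bq; q)_n) = (−aq; q)_∞ · ∑_{n=0}^{∞} b^n q^{n(n+1)/2} / ((q; q)_n · (−aq; q)_n). -/

import Mathlib

/-- The finite q-Pochhammer symbol `(a; q)_n = ∏_{j=0}^{n-1} (1 - a q^j)`. -/
noncomputable def qPoch (a q : ℂ) (n : ℕ) : ℂ := ∏ j ∈ Finset.range n, (1 - a * q ^ j)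

/-- The infinite q-Pochhammer symbol `(a; q)_∞ = ∏_{j=0}^{∞} (1 - a q^j)`. -/
noncomputable def qPochInf (a q : ℂ) : ℂ := ∏' j : ℕ, (1 - a * q ^ j)

/-- The terms of Euler's expansion of `(-bq; q)_∞` in powers of `b`. -/
noncomputable def eulerTerm (q b : ℂ) (m : ℕ) : ℂ :=
  b ^ m * q ^ (m * (m + 1) / 2) / qPoch q q m

theorem succ_mul_succ_add_one_div_two (m : ℕ) :
    (m + 1) * (m + 1 + 1) / 2 = m * (m + 1) / 2 + (m + 1) := by
  rw [show (m + 1) * (m + 1 + 1) = m * (m + 1) + (m + 1) * 2 by ring,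
    Nat.add_mul_div_right _ _ two_pos]

theorem one_sub_norm_le_norm_one_sub_mul_pow {q : ℂ} (hq : ‖q‖ < 1) (j : ℕ) :
    1 - ‖q‖ ≤ ‖1 - q * q ^ j‖ := by
  have h : ‖q * q ^ j‖ ≤ ‖q‖ := by
    rw [norm_mul, norm_pow]
    exact mul_le_of_le_one_right (norm_nonneg q) (pow_le_one₀ (norm_nonneg q) hq.le)
  have h2 := norm_sub_norm_le (1 : ℂ) (q * q ^ j)
  rw [norm_one] at h2
  linarith

theorem one_sub_norm_pow_le_norm_qPoch {q : ℂ} (hq : ‖q‖ < 1) (m : ℕ) :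
    (1 - ‖q‖) ^ m ≤ ‖qPoch q q m‖ := by
  rw [qPoch, norm_prod, ← Finset.card_range m, ← Finset.prod_const, Finset.card_range]
  exact Finset.prod_le_prod (fun _ _ => (sub_pos.2 hq).le)
    fun j _ => one_sub_norm_le_norm_one_sub_mul_pow hq j

theorem qPoch_self_ne_zero {q : ℂ} (hq : ‖q‖ < 1) (m : ℕ) : qPoch q q m ≠ 0 :=
  norm_pos_iff.1 ((pow_pos (sub_pos.2 hq) m).trans_le (one_sub_norm_pow_le_norm_qPoch hq m))

theorem qPoch_succ (a q : ℂ) (n : ℕ) : qPoch a q (n + 1) = qPoch a q n * (1 - a * q ^ n) :=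
  Finset.prod_range_succ _ _

theorem summable_pow_mul_pow_triangular {r : ℝ} (hr0 : 0 ≤ r) (hr : r < 1) (c : ℝ) :
    Summable fun m : ℕ => c ^ m * r ^ (m * (m + 1) / 2) := by
  have hlim : Filter.Tendsto (fun m : ℕ => |c| * r ^ (m + 1)) Filter.atTop (nhds 0) := by
    simpa using ((Filter.tendsto_add_atTop_iff_nat 1).2
      (tendsto_pow_atTop_nhds_zero_of_lt_one hr0 hr)).const_mul |c|
  refine summable_of_ratio_norm_eventually_le (r := 1 / 2) (by norm_num) ?_
  filter_upwards [hlim.eventually_le_const (show (0 : ℝ) < 1 / 2 by norm_num)] with m hm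
  have h : c ^ (m + 1) * r ^ ((m + 1) * (m + 1 + 1) / 2) =
      (c * r ^ (m + 1)) * (c ^ m * r ^ (m * (m + 1) / 2)) := by
    rw [succ_mul_succ_add_one_div_two]
    ring
  rw [h, norm_mul]
  refine mul_le_mul_of_nonneg_right ?_ (norm_nonneg _)
  rwa [norm_mul, norm_pow, Real.norm_eq_abs, Real.norm_eq_abs, abs_of_nonneg hr0]

theorem norm_eulerTerm_le {q : ℂ} (hq : ‖q‖ < 1) (b : ℂ) (m : ℕ) :
    ‖eulerTerm q b m‖ ≤ (‖b‖ / (1 - ‖q‖)) ^ m * ‖q‖ ^ (m * (m + 1) / 2) := by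
  rw [eulerTerm, norm_div, norm_mul, norm_pow, norm_pow, div_pow, div_mul_eq_mul_div]
  have := pow_pos (sub_pos.2 hq) m
  gcongr
  exact one_sub_norm_pow_le_norm_qPoch hq m

theorem summable_eulerTerm {q : ℂ} (hq : ‖q‖ < 1) (b : ℂ) : Summable (eulerTerm q b) :=
  .of_norm_bounded (summable_pow_mul_pow_triangular (norm_nonneg q) hq _) (norm_eulerTerm_le hq b)

theorem eulerTerm_mul_pow (q b : ℂ) (n m : ℕ) :
    eulerTerm q (b * q ^ n) m = q ^ (n * m) * eulerTerm q b m := by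
  rw [eulerTerm, eulerTerm, mul_pow, ← pow_mul]
  ring

theorem tsum_eulerTerm_eq_mul {q : ℂ} (hq : ‖q‖ < 1) (b : ℂ) :
    ∑' m, eulerTerm q b m = (1 + b * q) * ∑' m, eulerTerm q (b * q) m := by
  have hb := summable_eulerTerm hq b
  have hbq := summable_eulerTerm hq (b * q)
  have hstep (m : ℕ) : eulerTerm q b (m + 1) - eulerTerm q (b * q) (m + 1) =
      b * q * eulerTerm q (b * q) m := by
    have h0 := qPoch_self_ne_zero hq m
    have h1 : 1 - q * q ^ m ≠ 0 :=
      norm_pos_iff.1 ((sub_pos.2 hq).trans_le (one_sub_norm_le_norm_one_sub_mul_pow hq m))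
    simp only [eulerTerm, qPoch_succ, succ_mul_succ_add_one_div_two]
    field_simp
    ring
  have h : ∑' m, (eulerTerm q b m - eulerTerm q (b * q) m) =
      b * q * ∑' m, eulerTerm q (b * q) m := by
    rw [(hb.sub hbq).tsum_eq_zero_add, ← tsum_mul_left]
    simp only [hstep]
    simp [eulerTerm]
  rw [hb.tsum_sub hbq] at h
  linear_combination h

theorem tsum_eulerTerm_eq_qPoch_mul {q : ℂ} (hq : ‖q‖ < 1) (b : ℂ) (n : ℕ) :
    ∑' m, eulerTerm q b m = qPoch (-(b * q)) q n * ∑' m, eulerTerm q (b * q ^ n) m := by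
  induction n with
  | zero => simp [qPoch]
  | succ n ih =>
    rw [ih, tsum_eulerTerm_eq_mul hq, qPoch_succ, mul_assoc b, ← pow_succ]
    ring

theorem tendsto_tsum_eulerTerm_mul_pow {q : ℂ} (hq : ‖q‖ < 1) (b : ℂ) :
    Filter.Tendsto (fun n : ℕ => ∑' m, eulerTerm q (b * q ^ n) m) Filter.atTop (nhds 1) := by
  have h0 : ∑' m, eulerTerm q 0 m = 1 := by
    rw [tsum_eq_single 0 fun m hm => by simp [eulerTerm, hm]]
    simp [eulerTerm, qPoch]
  rw [← h0]
  refine tendsto_tsum_of_dominated_convergence (summable_eulerTerm hq b).norm (fun m => ?_)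
    (.of_forall fun n m => ?_)
  · have hc : Continuous fun x => eulerTerm q x m := by
      unfold eulerTerm
      fun_prop
    refine (hc.tendsto 0).comp ?_
    simpa using (tendsto_pow_atTop_nhds_zero_of_norm_lt_one hq).const_mul b
  · rw [eulerTerm_mul_pow, norm_mul, norm_pow]
    exact mul_le_of_le_one_left (norm_nonneg _) (pow_le_one₀ (norm_nonneg q) hq.le)

theorem tendsto_qPoch_qPochInf {q : ℂ} (hq : ‖q‖ < 1) (a : ℂ) :
    Filter.Tendsto (qPoch a q) Filter.atTop (nhds (qPochInf a q)) := by
  have hs : Summable fun j : ℕ => ‖-(a * q ^ j)‖ := by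
    simpa only [norm_neg, norm_mul, norm_pow] using
      (summable_geometric_of_lt_one (norm_nonneg q) hq).mul_left ‖a‖
  have hm := multipliable_one_add_of_summable hs
  simp only [← sub_eq_add_neg] at hm
  exact hm.hasProd.tendsto_prod_nat

/-- Euler's expansion of the infinite product `(-bq; q)_∞`. -/
theorem qPochInf_eq_tsum_eulerTerm {q : ℂ} (hq : ‖q‖ < 1) (b : ℂ) :
    qPochInf (-(b * q)) q = ∑' m, eulerTerm q b m := by
  have h := (tendsto_qPoch_qPochInf hq (-(b * q))).mul (tendsto_tsum_eulerTerm_mul_pow hq b)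
  simp only [← tsum_eulerTerm_eq_qPoch_mul hq b, mul_one] at h
  exact tendsto_nhds_unique h tendsto_const_nhds

theorem qPoch_neg_mul_ne_zero {q b : ℂ} (hb : ∀ N : ℕ, 0 < N → 1 + b * q ^ N ≠ 0) (n : ℕ) :
    qPoch (-(b * q)) q n ≠ 0 := by
  refine Finset.prod_ne_zero_iff.2 fun j _ => ?_
  convert hb (j + 1) j.succ_pos using 1
  ring

/-- The left-hand side of the symmetric identity as an iterated sum. -/
theorem qPochInf_mul_tsum_eq_tsum_tsum {q b : ℂ} (hq : ‖q‖ < 1)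
    (hb : ∀ N : ℕ, 0 < N → 1 + b * q ^ N ≠ 0) (a : ℂ) :
    qPochInf (-(b * q)) q *
        ∑' n : ℕ, a ^ n * q ^ (n * (n + 1) / 2) / (qPoch q q n * qPoch (-(b * q)) q n) =
      ∑' n, ∑' m, q ^ (n * m) * (eulerTerm q a n * eulerTerm q b m) := by
  rw [← tsum_mul_left]
  refine tsum_congr fun n => ?_
  have h0 := qPoch_self_ne_zero hq n
  have h1 := qPoch_neg_mul_ne_zero hb n
  have h2 : ∑' m, q ^ (n * m) * (eulerTerm q a n * eulerTerm q b m) =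
      eulerTerm q a n * ∑' m, eulerTerm q (b * q ^ n) m := by
    rw [← tsum_mul_left]
    refine tsum_congr fun m => ?_
    rw [eulerTerm_mul_pow]
    ring
  rw [h2, qPochInf_eq_tsum_eulerTerm hq, tsum_eulerTerm_eq_qPoch_mul hq b n, eulerTerm]
  field_simp

theorem summable_pow_mul_eulerTerm_mul_eulerTerm {q : ℂ} (hq : ‖q‖ < 1) (a b : ℂ) :
    Summable (Function.uncurry fun n m : ℕ =>
      q ^ (n * m) * (eulerTerm q a n * eulerTerm q b m)) := by
  refine .of_norm_bounded ((summable_eulerTerm hq a).norm.mul_of_nonneg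
    (summable_eulerTerm hq b).norm (fun _ => norm_nonneg _) fun _ => norm_nonneg _) fun p => ?_
  rw [Function.uncurry, norm_mul, norm_mul, norm_pow]
  exact mul_le_of_le_one_left (by positivity) (pow_le_one₀ (norm_nonneg q) hq.le)

/-- Theorem 4.3: for `|q| < 1` and `a`, `b` with `1 + a q^N ≠ 0`
and `1 + b q^N ≠ 0` for all positive integers `N`,
`(−bq; q)_∞ ∑_{n≥0} a^n q^{n(n+1)/2}/((q; q)_n (−bq; q)_n)
  = (−aq; q)_∞ ∑_{n≥0} b^n q^{n(n+1)/2}/((q; q)_n (−aq; q)_n)`. -/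
theorem entry_1_4_17_special (q a b : ℂ) (hq : ‖q‖ < 1)
    (ha : ∀ N : ℕ, 0 < N → 1 + a * q ^ N ≠ 0)
    (hb : ∀ N : ℕ, 0 < N → 1 + b * q ^ N ≠ 0) :
    qPochInf (-(b * q)) q *
        ∑' n : ℕ, a ^ n * q ^ (n * (n + 1) / 2) / (qPoch q q n * qPoch (-(b * q)) q n) =
      qPochInf (-(a * q)) q *
        ∑' n : ℕ, b ^ n * q ^ (n * (n + 1) / 2) / (qPoch q q n * qPoch (-(a * q)) q n) := by
  rw [qPochInf_mul_tsum_eq_tsum_tsum hq hb, qPochInf_mul_tsum_eq_tsum_tsum hq ha,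
    ← (summable_pow_mul_eulerTerm_mul_eulerTerm hq a b).tsum_comm]
  refine tsum_congr fun m => tsum_congr fun n => ?_
  rw [mul_comm n m, mul_comm (eulerTerm q a n)]
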